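/- Let u : ℝ × ℝ → ℝ be smooth, 2π-periodic in its second variable, and compactly supported in its first variable, and suppose that u is orthogonal in the Gaussian-weighted inner product to each of the functions 1, y, cos ϑ, and sin ϑ, i.e. ∫_ℝ ∫_0^{2π} u·e^{−y²/4} dϑ dy = ∫_ℝ ∫_0^{2π} u·y·e^{−y²/4} dϑ dy = ∫_ℝ ∫_0^{2π} u·cos ϑ·e^{−y²/4} dϑ dy = ∫_ℝ ∫_0^{2π} u·sin ϑ·e^{−y²/4} dϑ dy = 0. Then ∫_ℝ ∫_0^{2π} ((∂_y u)² + (1/2)(∂_ϑ u)²)·e^{−y²/4} dϑ dy ≥ ∫_ℝ ∫_0^{2π} u²·e^{−y²/4} dϑ dy. -/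

import Mathlib

open Real MeasureTheory

noncomputable def csgG (y : ℝ) : ℝ := Real.exp (-(y ^ 2) / 4)

lemma csgG_pos (y : ℝ) : 0 < csgG y := Real.exp_pos _

lemma csgG_cont : Continuous csgG := by unfold csgG; fun_prop

lemma csgG_deriv (y : ℝ) : HasDerivAt csgG (-(y / 2) * csgG y) y := by
  have h : HasDerivAt (fun y : ℝ => -(y ^ 2) / 4) (-(y / 2)) y := by
    have := ((hasDerivAt_id y).pow 2).neg.div_const 4
    refine HasDerivAt.congr_deriv this ?_
    simp; ring
  have := h.exp
  refine HasDerivAt.congr_deriv this ?_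
  unfold csgG; ring

lemma csg_exists_h (R : ℝ) (f : ℝ → ℝ) (hf : Continuous f)
    (h0 : ∫ y in (-R)..R, f y * csgG y = 0) :
    ∃ h : ℝ → ℝ, (∀ y, HasDerivAt h (f y + y / 2 * h y) y) ∧ h (-R) = 0 ∧ h R = 0 := by
  have hc : Continuous (fun y => f y * csgG y) := hf.mul csgG_cont
  refine ⟨fun y => (∫ t in (-R)..y, f t * csgG t) / csgG y, fun y => ?_, by simp, by simp [h0]⟩
  have h1 : HasDerivAt (fun y => ∫ t in (-R)..y, f t * csgG t) (f y * csgG y) y :=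
    intervalIntegral.integral_hasDerivAt_right (hc.intervalIntegrable _ _)
      (hc.stronglyMeasurableAtFilter _ _) hc.continuousAt
  have h2 := h1.div (csgG_deriv y) (csgG_pos y).ne'
  refine HasDerivAt.congr_deriv h2 ?_
  have := (csgG_pos y).ne'
  field_simp
  ring

lemma csg_ftc (a b : ℝ) (F F' : ℝ → ℝ) (hF : ∀ y, HasDerivAt F (F' y) y) (hc : Continuous F')
    (ha : F a = 0) (hb : F b = 0) : ∫ y in a..b, F' y = 0 := by
  rw [intervalIntegral.integral_eq_sub_of_hasDerivAt (fun y _ => hF y) (hc.intervalIntegrable _ _),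
    ha, hb, sub_zero]

lemma csg_key (R : ℝ) (h h' : ℝ → ℝ) (hd : ∀ y, HasDerivAt h (h' y) y) (hc' : Continuous h')
    (ha : h (-R) = 0) (hb : h R = 0) :
    ∫ y in (-R)..R, (h' y - y / 2 * h y) ^ 2 * csgG y =
      (∫ y in (-R)..R, h' y ^ 2 * csgG y) + 1 / 2 * ∫ y in (-R)..R, h y ^ 2 * csgG y := by
  have hc : Continuous h := continuous_iff_continuousAt.2 fun y => (hd y).continuousAt
  have hG := csgG_cont
  have hz := csg_ftc (-R) R (fun y => -(1 / 2) * (y * h y ^ 2 * csgG y))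
    (fun y => (h' y - y / 2 * h y) ^ 2 * csgG y - (h' y ^ 2 * csgG y + 1 / 2 * (h y ^ 2 * csgG y)))
    (fun y => by
      have := ((((hasDerivAt_id y).mul ((hd y).pow 2)).mul (csgG_deriv y)).const_mul (-(1 / 2)))
      refine HasDerivAt.congr_deriv this ?_
      simp; ring) (by fun_prop) (by simp [ha]) (by simp [hb])
  rw [intervalIntegral.integral_sub, intervalIntegral.integral_add,
    intervalIntegral.integral_const_mul] at hz
  · linarith
  all_goals exact Continuous.intervalIntegrable (by fun_prop) _ _

lemma csg_pair (R c : ℝ) (hR : 0 ≤ R) (f f' h : ℝ → ℝ) (hf : ∀ y, HasDerivAt f (f' y) y)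
    (hc' : Continuous f')
    (hd : ∀ y, HasDerivAt h (f y + y / 2 * h y) y) (ha : h (-R) = 0) (hb : h R = 0) :
    2 * c * (∫ y in (-R)..R, f y ^ 2 * csgG y) - c ^ 2 * (∫ y in (-R)..R, h y ^ 2 * csgG y)
      ≤ ∫ y in (-R)..R, f' y ^ 2 * csgG y := by
  have hc : Continuous h := continuous_iff_continuousAt.2 fun y => (hd y).continuousAt
  have hcf : Continuous f := continuous_iff_continuousAt.2 fun y => (hf y).continuousAt
  have hG := csgG_cont
  have hz := csg_ftc (-R) R (fun y => f y * h y * csgG y)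
    (fun y => f' y * h y * csgG y + f y ^ 2 * csgG y)
    (fun y => by
      have := (((hf y).mul (hd y)).mul (csgG_deriv y))
      refine HasDerivAt.congr_deriv this ?_
      simp; ring) (by fun_prop) (by simp [ha]) (by simp [hb])
  have hp : 0 ≤ ∫ y in (-R)..R, (f' y + c * h y) ^ 2 * csgG y :=
    intervalIntegral.integral_nonneg (by linarith)
      fun y _ => mul_nonneg (sq_nonneg _) (csgG_pos y).le
  have he : ∫ y in (-R)..R, (f' y + c * h y) ^ 2 * csgG y =
      ∫ y in (-R)..R, (f' y ^ 2 * csgG y + c ^ 2 * (h y ^ 2 * csgG y)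
        + (2 * c) * (f' y * h y * csgG y)) := by
    congr 1; ext y; ring
  rw [he, intervalIntegral.integral_add, intervalIntegral.integral_add,
    intervalIntegral.integral_const_mul, intervalIntegral.integral_const_mul] at hp
  · rw [intervalIntegral.integral_add] at hz
    · have : (∫ y in (-R)..R, f' y * h y * csgG y) = - ∫ y in (-R)..R, f y ^ 2 * csgG y := by
        linarith
      rw [this] at hp
      linarith
    all_goals exact Continuous.intervalIntegrable (by fun_prop) _ _
  all_goals exact Continuous.intervalIntegrable (by fun_prop) _ _

lemma csg_h_norm (R : ℝ) (f h : ℝ → ℝ) (hcf : Continuous f)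
    (hd : ∀ y, HasDerivAt h (f y + y / 2 * h y) y) (ha : h (-R) = 0) (hb : h R = 0) :
    ∫ y in (-R)..R, f y ^ 2 * csgG y =
      (∫ y in (-R)..R, (f y + y / 2 * h y) ^ 2 * csgG y)
        + 1 / 2 * ∫ y in (-R)..R, h y ^ 2 * csgG y := by
  have hc : Continuous h := continuous_iff_continuousAt.2 fun y => (hd y).continuousAt
  rw [← csg_key R h _ hd (by fun_prop) ha hb]
  simp

/-- Gaussian Poincare inequality. -/
lemma csg_poincare (R : ℝ) (hR : 0 ≤ R) (f f' : ℝ → ℝ) (hf : ∀ y, HasDerivAt f (f' y) y)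
    (hc' : Continuous f') (h0 : ∫ y in (-R)..R, f y * csgG y = 0) :
    1 / 2 * (∫ y in (-R)..R, f y ^ 2 * csgG y) ≤ ∫ y in (-R)..R, f' y ^ 2 * csgG y := by
  have hcf : Continuous f := continuous_iff_continuousAt.2 fun y => (hf y).continuousAt
  obtain ⟨h, hd, ha, hb⟩ := csg_exists_h R f hcf h0
  have h1 := csg_pair R (1 / 2) hR f f' h hf hc' hd ha hb
  have h2 := csg_h_norm R f h hcf hd ha hb
  have hp : 0 ≤ ∫ y in (-R)..R, (f y + y / 2 * h y) ^ 2 * csgG y :=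
    intervalIntegral.integral_nonneg (by linarith)
      fun y _ => mul_nonneg (sq_nonneg _) (csgG_pos y).le
  linarith

/-- Second-order Gaussian Poincare inequality. -/
lemma csg_poincare2 (R : ℝ) (hR : 0 ≤ R) (f f' : ℝ → ℝ) (hf : ∀ y, HasDerivAt f (f' y) y)
    (hc' : Continuous f') (h0 : ∫ y in (-R)..R, f y * csgG y = 0)
    (h1 : ∫ y in (-R)..R, f y * y * csgG y = 0) :
    (∫ y in (-R)..R, f y ^ 2 * csgG y) ≤ ∫ y in (-R)..R, f' y ^ 2 * csgG y := by
  have hcf : Continuous f := continuous_iff_continuousAt.2 fun y => (hf y).continuousAt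
  obtain ⟨h, hd, ha, hb⟩ := csg_exists_h R f hcf h0
  have hc : Continuous h := continuous_iff_continuousAt.2 fun y => (hd y).continuousAt
  have hG := csgG_cont
  have hz := csg_ftc (-R) R (fun y => y * h y * csgG y)
    (fun y => h y * csgG y + f y * y * csgG y)
    (fun y => by
      have := (((hasDerivAt_id y).mul (hd y)).mul (csgG_deriv y))
      refine HasDerivAt.congr_deriv this ?_
      simp; ring) (by fun_prop) (by simp [ha]) (by simp [hb])
  rw [intervalIntegral.integral_add, h1, add_zero] at hz
  · have h3 := csg_poincare R hR h _ hd (by fun_prop) hz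
    have h1 := csg_pair R 1 hR f f' h hf hc' hd ha hb
    have h2 := csg_h_norm R f h hcf hd ha hb
    linarith
  all_goals exact Continuous.intervalIntegrable (by fun_prop) _ _

lemma csg_wirtinger (f f' : ℝ → ℝ) (hf : ∀ y, HasDerivAt f (f' y) y) (hc' : Continuous f')
    (hper : f (2 * π) = f 0) :
    (∫ t in (0:ℝ)..(2 * π), f t ^ 2) - (∫ t in (0:ℝ)..(2 * π), f t) ^ 2 / (2 * π)
      - ((∫ t in (0:ℝ)..(2 * π), f t * cos t) ^ 2 + (∫ t in (0:ℝ)..(2 * π), f t * sin t) ^ 2) / (2 * π)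
      ≤ 1 / 2 * ∫ t in (0:ℝ)..(2 * π), f' t ^ 2 := by
  have hcf : Continuous f := continuous_iff_continuousAt.2 fun y => (hf y).continuousAt
  have hab : (0:ℝ) < 2 * π := by positivity
  have memlp : ∀ g : ℝ → ℝ, Continuous g →
      MemLp (fun t => (g t : ℂ)) 2 (volume.restrict (Set.Ioc 0 (2 * π))) := by
    intro g hg
    have : Continuous (fun t => (g t : ℂ)) := by fun_prop
    obtain ⟨M, hM⟩ := (isCompact_Icc (a := (0:ℝ)) (b := 2 * π)).exists_bound_of_continuousOn
      this.continuousOn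
    refine MemLp.of_bound this.aestronglyMeasurable M ?_
    exact (ae_restrict_mem measurableSet_Ioc).mono fun t ht => hM t (Set.Ioc_subset_Icc_self ht)
  have s1 := hasSum_sq_fourierCoeffOn hab (memlp f hcf)
  have s2 := hasSum_sq_fourierCoeffOn hab (memlp f' hc')
  simp only [Complex.norm_real, Real.norm_eq_abs, sq_abs, sub_zero, smul_eq_mul] at s1 s2
  set c := fun n : ℤ => fourierCoeffOn hab (fun t => (f t : ℂ)) n with hcdef
  set d := fun n : ℤ => fourierCoeffOn hab (fun t => (f' t : ℂ)) n with hddef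
  have hcd : ∀ n : ℤ, n ≠ 0 → ‖d n‖ ^ 2 = (n:ℝ) ^ 2 * ‖c n‖ ^ 2 := by
    intro n hn
    have := fourierCoeffOn_of_hasDerivAt hab hn (f := fun t => (f t : ℂ)) (f' := fun t => (f' t : ℂ))
      (fun x _ => (hf x).ofReal_comp) (Continuous.intervalIntegrable (by fun_prop) _ _)
    have h2 : c n = 1 / (-2 * π * Complex.I * n) * (- (2 * π) * d n) := by
      simp only [hcdef, hddef, this, hper]; simp
    have hn' : (n : ℂ) ≠ 0 := by exact_mod_cast hn
    have hpi : (π : ℂ) ≠ 0 := by exact_mod_cast pi_ne_zero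
    have h3 : d n = Complex.I * n * c n := by
      rw [h2]; field_simp [Complex.I_ne_zero]
    rw [h3]; simp [mul_pow]
  have hc0 : ‖c 0‖ ^ 2 = (∫ t in (0:ℝ)..(2 * π), f t) ^ 2 / (2 * π) ^ 2 := by
    have : c 0 = (((∫ t in (0:ℝ)..(2 * π), f t) / (2 * π) : ℝ) : ℂ) := by
      simp only [hcdef, fourierCoeffOn_eq_integral]
      simp [intervalIntegral.integral_ofReal]
      ring
    rw [this, Complex.norm_real, Real.norm_eq_abs, sq_abs, div_pow]
  have hc1 : ∀ ε : ℤ, (ε = 1 ∨ ε = -1) → ‖c ε‖ ^ 2 =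
      ((∫ t in (0:ℝ)..(2 * π), f t * cos t) ^ 2 + (∫ t in (0:ℝ)..(2 * π), f t * sin t) ^ 2)
        / (2 * π) ^ 2 := by
    intro ε hε
    have : c ε = ((1 / (2 * π) : ℝ) : ℂ) * (((∫ t in (0:ℝ)..(2 * π), f t * cos t : ℝ) : ℂ)
        - ε * ((∫ t in (0:ℝ)..(2 * π), f t * sin t : ℝ) : ℂ) * Complex.I) := by
      simp only [hcdef, fourierCoeffOn_eq_integral]
      rw [← intervalIntegral.integral_ofReal, ← intervalIntegral.integral_ofReal,
        ← intervalIntegral.integral_const_mul, ← intervalIntegral.integral_mul_const,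
        ← intervalIntegral.integral_sub]
      · rw [Complex.real_smul, sub_zero]
        congr 1
        apply intervalIntegral.integral_congr
        intro t _
        simp only [fourier_coe_apply, smul_eq_mul]
        have : (2 * π * Complex.I * ((-ε : ℤ) : ℂ) * t / ((2 * π : ℝ) : ℂ)) =
            ((-ε * t : ℝ) : ℂ) * Complex.I := by
          have hpi : (π : ℂ) ≠ 0 := by exact_mod_cast pi_ne_zero
          push_cast; field_simp
        rw [this, Complex.exp_mul_I, ← Complex.ofReal_cos, ← Complex.ofReal_sin]
        rcases hε with rfl | rfl <;> simp <;> ring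
      all_goals exact Continuous.intervalIntegrable (by fun_prop) _ _
    rw [this, norm_mul, mul_pow, Complex.norm_real, Real.norm_eq_abs, sq_abs,
      ← Complex.normSq_eq_norm_sq, Complex.normSq_apply]
    rcases hε with rfl | rfl <;> simp <;> ring
  have hs := (s2.mul_left (1 / 2)).sub s1
  have hle := sum_le_hasSum ({-1, 0, 1} : Finset ℤ) (fun n hn => ?_) hs
  · rw [Finset.sum_insert (by decide), Finset.sum_insert (by decide), Finset.sum_singleton] at hle
    have e1 := hcd 1 (by decide)
    have e2 := hcd (-1) (by decide)
    have e3 := hc1 1 (by simp)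
    have e4 := hc1 (-1) (by simp)
    have e0 : 0 ≤ ‖d 0‖ ^ 2 := by positivity
    simp only [← hcdef, ← hddef] at hle
    change 1 / 2 * ‖d (-1)‖ ^ 2 - ‖c (-1)‖ ^ 2 + (1 / 2 * ‖d 0‖ ^ 2 - ‖c 0‖ ^ 2
      + (1 / 2 * ‖d 1‖ ^ 2 - ‖c 1‖ ^ 2)) ≤ _ at hle
    rw [e1, e2, e3, e4, hc0] at hle
    push_cast at hle
    set P := ∫ t in (0:ℝ)..(2 * π), f t ^ 2
    set Q := ∫ t in (0:ℝ)..(2 * π), f' t ^ 2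
    set A := (∫ t in (0:ℝ)..(2 * π), f t) ^ 2
    set B := (∫ t in (0:ℝ)..(2 * π), f t * cos t) ^ 2 + (∫ t in (0:ℝ)..(2 * π), f t * sin t) ^ 2
    have h5 : -(B / (2 * π) ^ 2) - A / (2 * π) ^ 2 ≤ 1 / 2 * ((2 * π)⁻¹ * Q) - (2 * π)⁻¹ * P := by
      linarith
    have h6 := mul_le_mul_of_nonneg_left h5 hab.le
    have e5 : (2 * π) * (-(B / (2 * π) ^ 2) - A / (2 * π) ^ 2) = - (B / (2 * π)) - A / (2 * π) := by
      field_simp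
    have e6 : (2 * π) * (1 / 2 * ((2 * π)⁻¹ * Q) - (2 * π)⁻¹ * P) = 1 / 2 * Q - P := by
      field_simp
    rw [e5, e6] at h6
    linarith
  · simp only [Finset.mem_insert, Finset.mem_singleton, not_or] at hn
    have := hcd n hn.2.1
    change 0 ≤ 1 / 2 * ‖d n‖ ^ 2 - ‖c n‖ ^ 2
    rw [this]
    have h4 : (4 : ℤ) ≤ n ^ 2 := by
      have : 2 ≤ n ∨ n ≤ -2 := by omega
      rcases this with h | h <;> nlinarith
    have h4' : (4 : ℝ) ≤ (n:ℝ) ^ 2 := by exact_mod_cast h4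
    nlinarith [sq_nonneg ‖c n‖]

lemma csg_bessel (g : ℝ → ℝ) (hg : Continuous g) :
    (∫ t in (0:ℝ)..(2 * π), g t) ^ 2 / (2 * π)
      + ((∫ t in (0:ℝ)..(2 * π), g t * cos t) ^ 2 + (∫ t in (0:ℝ)..(2 * π), g t * sin t) ^ 2) / π
      ≤ ∫ t in (0:ℝ)..(2 * π), g t ^ 2 := by
  have hab : (0:ℝ) < 2 * π := by positivity
  set A := ∫ t in (0:ℝ)..(2 * π), g t with hA
  set B := ∫ t in (0:ℝ)..(2 * π), g t * cos t with hB
  set C := ∫ t in (0:ℝ)..(2 * π), g t * sin t with hC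
  have key : ∀ a b c : ℝ, 0 ≤ (∫ t in (0:ℝ)..(2 * π), g t ^ 2) - 2 * a * A - 2 * b * B - 2 * c * C
      + 2 * π * a ^ 2 + π * b ^ 2 + π * c ^ 2 := by
    intro a b c
    have hp : 0 ≤ ∫ t in (0:ℝ)..(2 * π), (g t - a - b * cos t - c * sin t) ^ 2 :=
      intervalIntegral.integral_nonneg hab.le fun y _ => sq_nonneg _
    have he : (∫ t in (0:ℝ)..(2 * π), (g t - a - b * cos t - c * sin t) ^ 2) =
        ∫ t in (0:ℝ)..(2 * π), (g t ^ 2 - (2 * a) * g t - (2 * b) * (g t * cos t)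
          - (2 * c) * (g t * sin t) + a ^ 2 + (2 * a * b) * cos t + (2 * a * c) * sin t
          + (2 * b * c) * (sin t * cos t) + b ^ 2 * cos t ^ 2 + c ^ 2 * sin t ^ 2) := by
      congr 1; ext t; ring
    rw [he] at hp
    repeat rw [intervalIntegral.integral_add] at hp
    · repeat rw [intervalIntegral.integral_sub] at hp
      · simp only [intervalIntegral.integral_const_mul, integral_cos, integral_sin,
          integral_sin_mul_cos₁, integral_cos_sq, integral_sin_sq,
          intervalIntegral.integral_const] at hp
        simp at hp
        rw [← hA, ← hB, ← hC] at hp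
        linarith
      all_goals exact Continuous.intervalIntegrable (by fun_prop) _ _
    all_goals exact Continuous.intervalIntegrable (by fun_prop) _ _
  have := key (A / (2 * π)) (B / π) (C / π)
  have e1 : (2 * π) * (A / (2 * π)) ^ 2 = A ^ 2 / (2 * π) := by field_simp
  have e2 : π * (B / π) ^ 2 = B ^ 2 / π := by field_simp
  have e3 : π * (C / π) ^ 2 = C ^ 2 / π := by field_simp
  rw [e1, e2, e3] at this
  have e4 : 2 * (A / (2 * π)) * A = 2 * (A ^ 2 / (2 * π)) := by ring
  have e5 : 2 * (B / π) * B = 2 * (B ^ 2 / π) := by ring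
  have e6 : 2 * (C / π) * C = 2 * (C ^ 2 / π) := by ring
  rw [e4, e5, e6] at this
  rw [add_div]
  linarith

lemma csg_param (F F' : ℝ → ℝ → ℝ) (hF : Continuous (fun p : ℝ × ℝ => F p.1 p.2))
    (hF' : Continuous (fun p : ℝ × ℝ => F' p.1 p.2))
    (hd : ∀ y t, HasDerivAt (fun s => F s t) (F' y t) y) (a b y : ℝ) :
    HasDerivAt (fun y => ∫ t in a..b, F y t) (∫ t in a..b, F' y t) y := by
  have cF : ∀ y, Continuous (F y) := fun y => hF.comp (by fun_prop : Continuous fun t => (y, t))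
  have cF' : ∀ y, Continuous (F' y) := fun y => hF'.comp (by fun_prop : Continuous fun t => (y, t))
  obtain ⟨M, hM⟩ := ((isCompact_Icc (a := y - 1) (b := y + 1)).prod
    (isCompact_uIcc (a := a) (b := b))).exists_bound_of_continuousOn hF'.continuousOn
  refine (intervalIntegral.hasDerivAt_integral_of_dominated_loc_of_deriv_le (bound := fun _ => M)
    (Icc_mem_nhds (by linarith : y - 1 < y) (by linarith : y < y + 1))
    (Filter.Eventually.of_forall fun x => (cF x).aestronglyMeasurable)
    ((cF y).intervalIntegrable _ _) (cF' y).aestronglyMeasurable ?_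
    intervalIntegrable_const ?_).2
  · refine Filter.Eventually.of_forall fun t ht x hx => hM (x, t) ⟨hx, Set.uIoc_subset_uIcc ht⟩
  · exact Filter.Eventually.of_forall fun t _ x _ => hd x t

lemma csg_restrict (R : ℝ) (hR : 0 ≤ R) (F : ℝ → ℝ) (hF : ∀ y, R ≤ |y| → F y = 0) :
    ∫ y, F y = ∫ y in (-R)..R, F y := by
  rw [intervalIntegral.integral_of_le (by linarith), setIntegral_eq_integral_of_forall_compl_eq_zero]
  intro y hy
  apply hF
  by_contra! h
  exact hy ⟨(abs_lt.1 h).1, (abs_lt.1 h).2.le⟩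

lemma csg_assemble (R : ℝ) (hR : 0 ≤ R) (A A' B B' C C' N D : ℝ → ℝ)
    (cA : Continuous A) (cA' : Continuous A') (cB : Continuous B) (cB' : Continuous B')
    (cC : Continuous C) (cC' : Continuous C') (cN : Continuous N) (cD : Continuous D)
    (hA : (∫ y in (-R)..R, A y ^ 2 * csgG y) ≤ ∫ y in (-R)..R, A' y ^ 2 * csgG y)
    (hB : 1 / 2 * (∫ y in (-R)..R, B y ^ 2 * csgG y) ≤ ∫ y in (-R)..R, B' y ^ 2 * csgG y)
    (hC : 1 / 2 * (∫ y in (-R)..R, C y ^ 2 * csgG y) ≤ ∫ y in (-R)..R, C' y ^ 2 * csgG y)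
    (pw : ∀ y, N y + (1 / (2 * π)) * (A' y ^ 2 - A y ^ 2)
      + (1 / π) * (B' y ^ 2 - 1 / 2 * B y ^ 2) + (1 / π) * (C' y ^ 2 - 1 / 2 * C y ^ 2) ≤ D y) :
    (∫ y in (-R)..R, N y * csgG y) ≤ ∫ y in (-R)..R, D y * csgG y := by
  have hG := csgG_cont
  have hm : (∫ y in (-R)..R, (N y * csgG y
      + (1 / (2 * π)) * (A' y ^ 2 * csgG y - A y ^ 2 * csgG y)
      + (1 / π) * (B' y ^ 2 * csgG y - 1 / 2 * (B y ^ 2 * csgG y))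
      + (1 / π) * (C' y ^ 2 * csgG y - 1 / 2 * (C y ^ 2 * csgG y))))
      ≤ ∫ y in (-R)..R, D y * csgG y := by
    apply intervalIntegral.integral_mono_on (by linarith)
    · exact Continuous.intervalIntegrable (by fun_prop) _ _
    · exact Continuous.intervalIntegrable (by fun_prop) _ _
    · intro y _
      have := mul_le_mul_of_nonneg_right (pw y) (csgG_pos y).le
      refine le_trans (le_of_eq ?_) this
      ring
  rw [intervalIntegral.integral_add, intervalIntegral.integral_add, intervalIntegral.integral_add,
    intervalIntegral.integral_const_mul, intervalIntegral.integral_const_mul,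
    intervalIntegral.integral_const_mul, intervalIntegral.integral_sub,
    intervalIntegral.integral_sub, intervalIntegral.integral_sub,
    intervalIntegral.integral_const_mul, intervalIntegral.integral_const_mul] at hm
  · have p1 : 0 ≤ 1 / (2 * π) := by positivity
    have p2 : 0 ≤ 1 / π := by positivity
    have q1 := mul_nonneg p1 (sub_nonneg.2 hA)
    have q2 := mul_nonneg p2 (sub_nonneg.2 hB)
    have q3 := mul_nonneg p2 (sub_nonneg.2 hC)
    linarith
  all_goals exact Continuous.intervalIntegrable (by fun_prop) _ _

/-- Spectral gap estimate on the Gaussian-weighted cylinder: if `u` is orthogonal to the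
unstable modes `1`, `y`, `cos ϑ`, `sin ϑ`, then the Dirichlet energy dominates the
weighted L² norm. -/
theorem cylinder_spectral_gap (u : ℝ → ℝ → ℝ)
    (hu : ContDiff ℝ (⊤ : ℕ∞) (fun p : ℝ × ℝ => u p.1 p.2))
    (hper : ∀ y : ℝ, Function.Periodic (u y) (2 * Real.pi))
    (hsupp : ∃ R : ℝ, ∀ y ϑ : ℝ, R ≤ |y| → u y ϑ = 0)
    (h1 : ∫ y : ℝ, ∫ ϑ in (0 : ℝ)..(2 * Real.pi),
        u y ϑ * Real.exp (-(y ^ 2) / 4) = 0)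
    (hy : ∫ y : ℝ, ∫ ϑ in (0 : ℝ)..(2 * Real.pi),
        u y ϑ * y * Real.exp (-(y ^ 2) / 4) = 0)
    (hcos : ∫ y : ℝ, ∫ ϑ in (0 : ℝ)..(2 * Real.pi),
        u y ϑ * Real.cos ϑ * Real.exp (-(y ^ 2) / 4) = 0)
    (hsin : ∫ y : ℝ, ∫ ϑ in (0 : ℝ)..(2 * Real.pi),
        u y ϑ * Real.sin ϑ * Real.exp (-(y ^ 2) / 4) = 0) :
    ∫ y : ℝ, ∫ ϑ in (0 : ℝ)..(2 * Real.pi),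
        ((deriv (fun s => u s ϑ) y) ^ 2 + 1 / 2 * (deriv (fun t => u y t) ϑ) ^ 2)
          * Real.exp (-(y ^ 2) / 4)
      ≥ ∫ y : ℝ, ∫ ϑ in (0 : ℝ)..(2 * Real.pi), (u y ϑ) ^ 2 * Real.exp (-(y ^ 2) / 4) := by
  obtain ⟨R₀, hR₀⟩ := hsupp
  obtain ⟨R, hR, hlt⟩ : ∃ R : ℝ, 0 ≤ R ∧ R₀ < R :=
    ⟨max R₀ 0 + 1, by positivity, by linarith [le_max_left R₀ 0]⟩
  set U : ℝ × ℝ → ℝ := fun p => u p.1 p.2 with hU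
  have hUd : ∀ p, HasFDerivAt U (fderiv ℝ U p) p := fun p =>
    ((hu.differentiable (by simp)) p).hasFDerivAt
  have hUc : Continuous (fderiv ℝ U) := hu.continuous_fderiv (by simp)
  set Y : ℝ → ℝ → ℝ := fun y t => fderiv ℝ U (y, t) (1, 0) with hY
  set T : ℝ → ℝ → ℝ := fun y t => fderiv ℝ U (y, t) (0, 1) with hT
  have cu : Continuous (fun p : ℝ × ℝ => u p.1 p.2) := hu.continuous
  have cY : Continuous (fun p : ℝ × ℝ => Y p.1 p.2) := by
    simp only [hY]; fun_prop
  have cT : Continuous (fun p : ℝ × ℝ => T p.1 p.2) := by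
    simp only [hT]; fun_prop
  have dY : ∀ y t, HasDerivAt (fun s => u s t) (Y y t) y := fun y t => by
    have := HasFDerivAt.comp_hasDerivAt (f := fun s : ℝ => (s, t)) y (hUd (y, t))
      ((hasDerivAt_id y).prodMk (hasDerivAt_const y t))
    exact this
  have dT : ∀ y t, HasDerivAt (fun s => u y s) (T y t) t := fun y t => by
    have := HasFDerivAt.comp_hasDerivAt (f := fun s : ℝ => (y, s)) t (hUd (y, t))
      ((hasDerivAt_const t y).prodMk (hasDerivAt_id t))
    exact this
  have u0 : ∀ y t, R ≤ |y| → u y t = 0 := fun y t h => hR₀ y t (by linarith)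
  have T0 : ∀ y t, R ≤ |y| → T y t = 0 := fun y t h => by
    rw [← (dT y t).deriv]
    have : (fun s => u y s) = fun _ => 0 := by ext s; exact u0 y s h
    rw [this]; simp
  have Y0 : ∀ y t, R ≤ |y| → Y y t = 0 := fun y t h => by
    rw [← (dY y t).deriv]
    have : (fun s => u s t) =ᶠ[nhds y] fun _ => 0 := by
      filter_upwards [(isOpen_lt continuous_const continuous_abs).mem_nhds
        (show y ∈ {s : ℝ | R₀ < |s|} from lt_of_lt_of_le hlt h)] with s hs
      exact hR₀ s t (le_of_lt hs)
    rw [this.deriv_eq]; simp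
  have sl : ∀ F : ℝ → ℝ → ℝ, Continuous (fun p : ℝ × ℝ => F p.1 p.2) → ∀ y, Continuous (F y) :=
    fun F hF y => hF.comp (by fun_prop : Continuous fun t => (y, t))
  have ci : ∀ F : ℝ → ℝ → ℝ, Continuous (fun p : ℝ × ℝ => F p.1 p.2) →
      Continuous fun y => ∫ t in (0:ℝ)..(2 * π), F y t := fun F hF =>
    intervalIntegral.continuous_parametric_intervalIntegral_of_continuous' hF _ _
  simp only [(dY _ _).deriv, (dT _ _).deriv]
  change ∫ y : ℝ, ∫ ϑ in (0 : ℝ)..(2 * π), u y ϑ * csgG y = 0 at h1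
  change ∫ y : ℝ, ∫ ϑ in (0 : ℝ)..(2 * π), u y ϑ * y * csgG y = 0 at hy
  change ∫ y : ℝ, ∫ ϑ in (0 : ℝ)..(2 * π), u y ϑ * cos ϑ * csgG y = 0 at hcos
  change ∫ y : ℝ, ∫ ϑ in (0 : ℝ)..(2 * π), u y ϑ * sin ϑ * csgG y = 0 at hsin
  change ∫ y : ℝ, ∫ ϑ in (0 : ℝ)..(2 * π), u y ϑ ^ 2 * csgG y ≤
    ∫ y : ℝ, ∫ ϑ in (0 : ℝ)..(2 * π), (Y y ϑ ^ 2 + 1 / 2 * T y ϑ ^ 2) * csgG y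
  simp only [intervalIntegral.integral_mul_const] at h1 hy hcos hsin ⊢
  rw [csg_restrict R hR _ (fun y h => by simp [u0 y _ h])] at h1 hy hcos hsin
  rw [csg_restrict R hR _ (fun y h => by simp [u0 y _ h]),
    csg_restrict R hR _ (fun y h => by simp [Y0 y _ h, T0 y _ h])]
  have cuc : Continuous (fun p : ℝ × ℝ => u p.1 p.2 * cos p.2) := by fun_prop
  have cus : Continuous (fun p : ℝ × ℝ => u p.1 p.2 * sin p.2) := by fun_prop
  have cYc : Continuous (fun p : ℝ × ℝ => Y p.1 p.2 * cos p.2) := by fun_prop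
  have cYs : Continuous (fun p : ℝ × ℝ => Y p.1 p.2 * sin p.2) := by fun_prop
  have hA := csg_poincare2 R hR _ _ (csg_param u Y cu cY dY 0 (2 * π)) (ci Y cY) h1 hy
  have hB := csg_poincare R hR _ _ (csg_param (fun y t => u y t * cos t) (fun y t => Y y t * cos t)
    cuc cYc (fun y t => (dY y t).mul_const _) 0 (2 * π)) (ci (fun y t => Y y t * cos t) cYc) hcos
  have hC := csg_poincare R hR _ _ (csg_param (fun y t => u y t * sin t) (fun y t => Y y t * sin t)
    cus cYs (fun y t => (dY y t).mul_const _) 0 (2 * π)) (ci (fun y t => Y y t * sin t) cYs) hsin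
  have cA := ci u cu
  have cA' := ci Y cY
  have cB := ci (fun y t => u y t * cos t) cuc
  have cB' := ci (fun y t => Y y t * cos t) cYc
  have cC := ci (fun y t => u y t * sin t) cus
  have cC' := ci (fun y t => Y y t * sin t) cYs
  have cN := ci (fun y t => u y t ^ 2) (by fun_prop)
  have cD := ci (fun y t => Y y t ^ 2 + 1 / 2 * T y t ^ 2) (by fun_prop)
  have pw : ∀ y, (∫ t in (0:ℝ)..(2 * π), u y t ^ 2)
      + (1 / (2 * π)) * ((∫ t in (0:ℝ)..(2 * π), Y y t) ^ 2 - (∫ t in (0:ℝ)..(2 * π), u y t) ^ 2)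
      + (1 / π) * ((∫ t in (0:ℝ)..(2 * π), Y y t * cos t) ^ 2
        - 1 / 2 * (∫ t in (0:ℝ)..(2 * π), u y t * cos t) ^ 2)
      + (1 / π) * ((∫ t in (0:ℝ)..(2 * π), Y y t * sin t) ^ 2
        - 1 / 2 * (∫ t in (0:ℝ)..(2 * π), u y t * sin t) ^ 2)
      ≤ ∫ t in (0:ℝ)..(2 * π), (Y y t ^ 2 + 1 / 2 * T y t ^ 2) := by
    intro y
    have w := csg_wirtinger (u y) (T y) (dT y) (sl T cT y) (by simpa using hper y 0)
    have b := csg_bessel (Y y) (sl Y cY y)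
    have := sl Y cY y
    have := sl T cT y
    rw [intervalIntegral.integral_add, intervalIntegral.integral_const_mul]
    · have := pi_pos
      refine le_trans (le_of_eq ?_) (add_le_add b w)
      field_simp
      ring
    all_goals exact Continuous.intervalIntegrable (by fun_prop) _ _
  exact csg_assemble R hR _ _ _ _ _ _ _ _ cA cA' cB cB' cC cC' cN cD hA hB hC pw
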